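/- Let A be a Krull domain and X a finitely generated torsion A-module. Then the characteristic ideal char_A(X) := {x ∈ A : ord_Q(x) ≥ length_{A_Q}(X_Q) for every height one prime Q of A} is an ideal of A containing the Fitting ideal Fitt_A(X). -/

import Mathlib

/-- The length of the cokernel of a square matrix with nonzero determinant over a principal ideal
domain is the order of vanishing of its determinant. -/
lemma Matrix.length_quotient_range_toLin'_eq_ord_det {B ι : Type*} [CommRing B] [IsDomain B]
    [IsPrincipalIdealRing B] [Fintype ι] [DecidableEq ι] (N : Matrix ι ι B) (hN : N.det ≠ 0) :
    Module.length B ((ι → B) ⧸ LinearMap.range N.toLin') = Ring.ord B N.det := by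
  set T := N.toLin'
  have hdet : LinearMap.det T = N.det := LinearMap.det_toLin' N
  have hinj : Function.Injective T := by
    rw [← LinearMap.ker_eq_bot, LinearMap.ker_eq_bot']
    exact fun v hv ↦ Matrix.eq_zero_of_mulVec_eq_zero hN hv
  let W := LinearMap.range T
  let e : (ι → B) ≃ₗ[B] W := LinearEquiv.ofInjective T hinj
  let b := Pi.basisFun B ι
  have hrank : Module.finrank B W = Module.finrank B (ι → B) := e.finrank_eq.symm
  let b₁ := Submodule.smithNormalFormTopBasis b hrank
  let b₂ := Submodule.smithNormalFormBotBasis b hrank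
  let a := Submodule.smithNormalFormCoeffs b hrank
  let e' : (ι → B) ≃ₗ[B] W := b₁.equiv b₂ (Equiv.refl ι)
  have hT : W.subtype ∘ₗ e.toLinearMap = T := by ext; rfl
  have hdiag : LinearMap.toMatrix b₁ b₁ (W.subtype ∘ₗ e'.toLinearMap) = Matrix.diagonal a := by
    ext i j
    have : ((b₂ j : W) : ι → B) = a j • b₁ j := Submodule.smithNormalFormBotBasis_def b hrank j
    simp only [LinearMap.toMatrix_apply, LinearMap.comp_apply, LinearEquiv.coe_coe,
      Submodule.subtype_apply, e', Module.Basis.equiv_apply, Equiv.refl_apply, this, map_smul,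
      Finsupp.smul_apply, Module.Basis.repr_self, Matrix.diagonal_apply, Finsupp.single_apply]
    obtain rfl | h := eq_or_ne i j
    · simp
    · simp [h, h.symm]
  have hassoc : Associated N.det (∏ i, a i) := by
    rw [← hdet, ← hT, ← Matrix.det_diagonal, ← hdiag, LinearMap.det_toMatrix]
    exact LinearMap.associated_det_comp_equiv W.subtype e e'
  have hprod (s : Finset ι) : Ring.ord B (∏ i ∈ s, a i) = ∑ i ∈ s, Ring.ord B (a i) := by
    classical
    induction s using Finset.induction_on with
    | empty => simp
    | insert i s hi ih =>
      rw [Finset.prod_insert hi, Finset.sum_insert hi, Ring.ord_mul' B, ih]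
      exact mem_nonZeroDivisors_of_ne_zero (Submodule.smithNormalFormCoeffs_ne_zero b hrank i)
  rw [Ring.ord_eq_of_associated hassoc, hprod,
    (Submodule.quotientEquivPiSpan W b hrank).length_eq, Module.length_pi_of_fintype]
  rfl

/-- Over a domain that is not a field, zero has infinite order of vanishing. -/
lemma Ring.ord_zero_eq_top {B : Type*} [CommRing B] [IsDomain B] (hB : ¬ IsField B) :
    Ring.ord B (0 : B) = ⊤ := by
  rw [Ring.ord_zero]
  by_contra h
  have := ((isFiniteLength_iff_isNoetherian_isArtinian).mp (Module.length_ne_top_iff.mp h)).2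
  exact hB (IsArtinianRing.isField_of_isDomain B)

/-- A quotient of `B ^ r` in which the columns of a square matrix vanish has length at most
the order of vanishing of the determinant. -/
lemma Module.length_le_ord_det {B Y ι : Type*} [CommRing B] [IsDomain B]
    [IsPrincipalIdealRing B] (hB : ¬ IsField B) [AddCommGroup Y] [Module B Y] [Fintype ι]
    [DecidableEq ι] (N : Matrix ι ι B) (ρ : (ι → B) →ₗ[B] Y) (hρ : Function.Surjective ρ)
    (hN : ∀ j, ρ (N.col j) = 0) :
    Module.length B Y ≤ Ring.ord B N.det := by
  by_cases h : N.det = 0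
  · rw [h, Ring.ord_zero_eq_top hB]
    exact le_top
  rw [← N.length_quotient_range_toLin'_eq_ord_det h]
  have hle : LinearMap.range N.toLin' ≤ LinearMap.ker ρ := by
    rw [Matrix.range_toLin', Submodule.span_le]
    rintro _ ⟨j, rfl⟩
    exact hN j
  refine Module.length_le_of_surjective (Submodule.liftQ _ ρ hle) ?_
  rw [← LinearMap.range_eq_top, Submodule.range_liftQ, LinearMap.range_eq_top]
  exact hρ

/-- Over a valuation ring, the order of vanishing satisfies the ultrametric inequality. -/
lemma Ring.min_ord_le_ord_add {B : Type*} [CommRing B] [IsDomain B] [ValuationRing B] (x y : B) :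
    min (Ring.ord B x) (Ring.ord B y) ≤ Ring.ord B (x + y) := by
  rcases ValuationRing.dvd_total x y with h | h
  · exact (min_le_left _ _).trans (Ring.ord_le_ord_of_dvd (dvd_add dvd_rfl h))
  · exact (min_le_right _ _).trans (Ring.ord_le_ord_of_dvd (dvd_add h dvd_rfl))

/-- The localization of a Noetherian integrally closed domain at a height one prime is a discrete
valuation ring. -/
lemma Localization.isDiscreteValuationRing_of_minimal {A : Type*} [CommRing A] [IsDomain A]
    [IsNoetherianRing A] [IsIntegrallyClosed A] (Q : Ideal A) [hQ : Q.IsPrime] (hne : Q ≠ ⊥)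
    (hmin : ∀ P : Ideal A, P.IsPrime → P < Q → P = ⊥) :
    IsDiscreteValuationRing (Localization Q.primeCompl) := by
  have hle : Q.primeCompl ≤ nonZeroDivisors A := Q.primeCompl_le_nonZeroDivisors
  have hfield : ¬ IsField (Localization Q.primeCompl) :=
    IsLocalization.AtPrime.not_isField A hne _
  have : IsNoetherianRing (Localization Q.primeCompl) :=
    IsLocalization.isNoetherianRing Q.primeCompl _ inferInstance
  have : IsIntegrallyClosed (Localization Q.primeCompl) :=
    isIntegrallyClosed_of_isLocalization _ Q.primeCompl hle
  have : Ring.DimensionLEOne (Localization Q.primeCompl) := by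
    refine ⟨fun {P} hP hPp ↦ ?_⟩
    have hPle := IsLocalRing.le_maximalIdeal hPp.ne_top
    have hcomap : P.under A = Q := by
      have hPQ : P.under A ≤ Q :=
        (Ideal.comap_mono hPle).trans_eq (Localization.AtPrime.under_maximalIdeal)
      by_contra hne'
      have : P.under A = ⊥ := hmin _ (hPp.comap _) (lt_of_le_of_ne hPQ hne')
      refine hP ?_
      rw [← IsLocalization.map_under Q.primeCompl _ P, this, Ideal.map_bot]
    have : P = IsLocalRing.maximalIdeal _ := by
      rw [← IsLocalization.map_under Q.primeCompl _ P, hcomap]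
      exact Localization.AtPrime.map_eq_maximalIdeal
    exact this ▸ inferInstance
  have : IsDedekindDomain (Localization Q.primeCompl) := {}
  exact ((IsDiscreteValuationRing.TFAE _ hfield).out 2 0).mp this

/-- If `X` is a quotient of `A ^ r` in which the columns of a square matrix vanish, then over a
localization of `A` that is a principal ideal domain but not a field, the length of the localized
module is at most the order of vanishing of the determinant. -/
lemma LocalizedModule.length_le_ord_det {A X ι : Type*} [CommRing A]
    [AddCommGroup X] [Module A X] (S : Submonoid A) [IsDomain (Localization S)]
    [IsPrincipalIdealRing (Localization S)] (hS : ¬ IsField (Localization S)) [Fintype ι]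
    [DecidableEq ι] (N : Matrix ι ι A) (π : (ι → A) →ₗ[A] X) (hπ : Function.Surjective π)
    (hN : ∀ j, π (N.col j) = 0) :
    Module.length (Localization S) (LocalizedModule S X) ≤
      Ring.ord (Localization S) (algebraMap A (Localization S) N.det) := by
  let v : ι → X := fun i ↦ π (Pi.single i 1)
  let f := LocalizedModule.mkLinearMap S X
  have hsum (c : ι → A) : ∑ i, c i • v i = π c := by
    conv_rhs => rw [pi_eq_sum_univ' c]
    simp [v, map_sum]
  have hspan : Submodule.span A (Set.range v) = ⊤ := by
    refine Submodule.eq_top_iff'.mpr fun x ↦ ?_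
    obtain ⟨c, rfl⟩ := hπ x
    rw [← hsum c]
    exact Submodule.sum_mem _ fun i _ ↦ Submodule.smul_mem _ _ (Submodule.subset_span ⟨i, rfl⟩)
  rw [RingHom.map_det]
  refine Module.length_le_ord_det hS _
    (Fintype.linearCombination (Localization S) (fun i ↦ f (v i))) ?_ fun j ↦ ?_
  · rw [← LinearMap.range_eq_top, Fintype.range_linearCombination, Set.range_comp' f v]
    exact span_eq_top_of_isLocalizedModule (Localization S) S f hspan
  · rw [Fintype.linearCombination_apply]
    simp only [Matrix.col_apply, RingHom.mapMatrix_apply, Matrix.map_apply, algebraMap_smul]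
    rw [← map_zero f, ← hN j, ← hsum, map_sum]
    simp [f]


/-- **The characteristic ideal contains the Fitting ideal.** Let `A` be a Krull domain
(a Noetherian, integrally closed domain) and `X` a finitely generated torsion `A`-module,
presented by the matrix `M` via `A^s → A^r → X → 0`.  The set
`char_A(X) = {x ∈ A : ord_Q(x) ≥ length_{A_Q}(X_Q) for every height-one prime Q}` is
(the carrier of) an ideal of `A` containing the Fitting ideal `Fitt_A(X)`.
Here `ord_Q(x)` is expressed as the length of `A_Q/(x)` over the discrete valuation ring
`A_Q`, and lengths are expressed as Krull dimensions of the submodule lattices. -/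
theorem charIdeal_contains_fittingIdeal {A : Type*} [CommRing A] [IsDomain A]
    [IsNoetherianRing A] [IsIntegrallyClosed A]
    (X : Type*) [AddCommGroup X] [Module A X] [Module.Finite A X]
    (htors : ∀ x : X, ∃ a : A, a ≠ 0 ∧ a • x = 0)
    (r s : ℕ) (M : Matrix (Fin r) (Fin s) A)
    (π : (Fin r → A) →ₗ[A] X) (hπ : Function.Surjective π)
    (hker : LinearMap.ker π =
      Submodule.span A (Set.range fun j : Fin s => fun i : Fin r => M i j)) :
    ∃ charIdeal : Ideal A,
      (charIdeal : Set A) =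
        {x : A | ∀ (Q : Ideal A) (hQ : Q.IsPrime), Q ≠ ⊥ →
          (∀ P : Ideal A, P.IsPrime → P < Q → P = ⊥) →
          Order.krullDim
              (Submodule (Localization (@Ideal.primeCompl A _ Q hQ))
                (LocalizedModule (@Ideal.primeCompl A _ Q hQ) X)) ≤
            Order.krullDim (Submodule (Localization (@Ideal.primeCompl A _ Q hQ))
              (Localization (@Ideal.primeCompl A _ Q hQ) ⧸
                Ideal.span {algebraMap A (Localization (@Ideal.primeCompl A _ Q hQ)) x}))} ∧
      Ideal.span {d : A | ∃ f : Fin r → Fin s,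
          d = Matrix.det (Matrix.of fun i j => M i (f j))} ≤ charIdeal := by
  have hdvr (Q : Ideal A) (hQ : Q.IsPrime) (hne : Q ≠ ⊥)
      (hmin : ∀ P : Ideal A, P.IsPrime → P < Q → P = ⊥) :=
    Localization.isDiscreteValuationRing_of_minimal Q hne hmin
  simp only [← Module.coe_length, WithBot.coe_le_coe]
  refine ⟨{ carrier := _, add_mem' := ?_, zero_mem' := ?_, smul_mem' := ?_ }, rfl, ?_⟩
  · intro x y hx hy Q hQ hne hmin
    have := hdvr Q hQ hne hmin
    rw [map_add]
    exact (le_min (hx Q hQ hne hmin) (hy Q hQ hne hmin)).trans (Ring.min_ord_le_ord_add _ _)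
  · intro Q hQ hne hmin
    have := hdvr Q hQ hne hmin
    rw [map_zero]
    exact le_top.trans_eq
      (Ring.ord_zero_eq_top (IsDiscreteValuationRing.not_isField _)).symm
  · intro c x hx Q hQ hne hmin
    rw [smul_eq_mul, map_mul]
    exact (hx Q hQ hne hmin).trans (Ring.ord_le_ord_mul _ _)
  · rw [Ideal.span_le]
    rintro _ ⟨f, rfl⟩ Q hQ hne hmin
    have := hdvr Q hQ hne hmin
    refine LocalizedModule.length_le_ord_det Q.primeCompl
      (IsDiscreteValuationRing.not_isField _) _ π hπ fun j ↦ ?_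
    rw [← LinearMap.mem_ker, hker]
    exact Submodule.subset_span ⟨f j, rfl⟩
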